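/- Under the stated setup, the squared Frobenius norm of the projected covariance matrix satisfies ‖P_vᵀ C P_t‖_F² = (1 − λ)⁴ Σ_{i=1}^k σ_i² + Σ_{i=k+1}^d σ_i². -/

import Mathlib

open Matrix Finset

/-- The squared Frobenius norm of a real matrix is the trace of its Gram matrix. -/
theorem sum_sq_eq_trace_transpose_mul {m n : Type*} [Fintype m] [Fintype n] (M : Matrix m n ℝ) :
    ∑ i, ∑ j, M i j ^ 2 = (Mᵀ * M).trace := by
  rw [Finset.sum_comm]
  simp [Matrix.trace, Matrix.mul_apply, sq]

/-- The squared Frobenius norm of `U D Wᵀ` with `U`, `W` orthogonal and `D` diagonal is the sum of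
the squared diagonal entries of `D`. -/
theorem sum_sq_mul_diagonal_mul_transpose {n : Type*} [Fintype n] [DecidableEq n]
    {U W : Matrix n n ℝ} (hU : Uᵀ * U = 1) (hW : Wᵀ * W = 1) (s : n → ℝ) :
    ∑ i, ∑ j, (U * diagonal s * Wᵀ) i j ^ 2 = ∑ i, s i ^ 2 := by
  have gram : (U * diagonal s * Wᵀ)ᵀ * (U * diagonal s * Wᵀ)
      = W * (diagonal s * (Uᵀ * U) * diagonal s * Wᵀ) := by
    simp only [transpose_mul, transpose_transpose, diagonal_transpose, Matrix.mul_assoc]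
  rw [sum_sq_eq_trace_transpose_mul, gram, trace_mul_comm, hU, Matrix.mul_one, Matrix.mul_assoc, hW,
    Matrix.mul_one, diagonal_mul_diagonal, trace_diagonal]
  simp only [sq]

/-- The Gram matrix of the rows of the first `k` columns of `U`, as a truncation of `U Uᵀ`. -/
theorem submatrix_castLE_mul_transpose {d k : ℕ} (hk : k ≤ d) (U : Matrix (Fin d) (Fin d) ℝ) :
    U.submatrix id (Fin.castLE hk) * (U.submatrix id (Fin.castLE hk))ᵀ
      = U * diagonal (fun i : Fin d => if (i : ℕ) < k then (1 : ℝ) else 0) * Uᵀ := by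
  have first_k : univ.filter (fun i : Fin d => (i : ℕ) < k) = univ.map (Fin.castLEEmb hk) := by
    ext i
    simp only [mem_filter, mem_univ, true_and, mem_map]
    exact ⟨fun h => ⟨⟨i, h⟩, rfl⟩, by rintro ⟨j, rfl⟩; exact j.isLt⟩
  ext i j
  rw [Matrix.mul_apply, Matrix.mul_apply]
  simp [mul_diagonal, ← Finset.sum_filter, first_k]

/-- A soft null-space projection is diagonal in the orthonormal basis of columns of `U`. -/
theorem one_sub_smul_submatrix_castLE_mul_transpose {d k : ℕ} (hk : k ≤ d) (lam : ℝ)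
    {U : Matrix (Fin d) (Fin d) ℝ} (hU : Uᵀ * U = 1) :
    1 - lam • (U.submatrix id (Fin.castLE hk) * (U.submatrix id (Fin.castLE hk))ᵀ)
      = U * diagonal (fun i : Fin d => if (i : ℕ) < k then 1 - lam else 1) * Uᵀ := by
  have diag : diagonal (fun i : Fin d => if (i : ℕ) < k then 1 - lam else 1)
      = 1 - lam • diagonal (fun i : Fin d => if (i : ℕ) < k then (1 : ℝ) else 0) := by
    rw [← diagonal_one, ← diagonal_smul, diagonal_sub]
    congr 1
    ext i
    by_cases h : (i : ℕ) < k <;> simp [h]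
  rw [submatrix_castLE_mul_transpose, diag, Matrix.mul_sub, Matrix.sub_mul, Matrix.mul_one,
    mul_eq_one_comm.mp hU, Matrix.mul_smul, Matrix.smul_mul]

/-- **Frobenius norm of the projected covariance.**  With `C = U Σ Wᵀ` for orthogonal
`U, W` and `Σ = diagonal σ`, and soft projections `P_v = I − λ U_k U_kᵀ`,
`P_t = I − λ W_k W_kᵀ`, the squared Frobenius norm `‖P_vᵀ C P_t‖_F² = ∑_{i,j} (⋅)_{ij}²`
equals `(1 − λ)⁴ ∑_{i ≤ k} σ_i² + ∑_{i > k} σ_i²`. -/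
theorem frobenius_norm_sq_projected_covariance
    (d k : ℕ) (hd : 1 ≤ d) (hk1 : 1 ≤ k) (hk : k ≤ d) (lam : ℝ)
    (U W : Matrix (Fin d) (Fin d) ℝ)
    (hU : Uᵀ * U = 1) (hW : Wᵀ * W = 1)
    (σ : Fin d → ℝ)
    (C : Matrix (Fin d) (Fin d) ℝ)
    (hC : C = U * Matrix.diagonal σ * Wᵀ)
    (Uk : Matrix (Fin d) (Fin k) ℝ) (hUk : Uk = U.submatrix id (Fin.castLE hk))
    (Wk : Matrix (Fin d) (Fin k) ℝ) (hWk : Wk = W.submatrix id (Fin.castLE hk))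
    (Pv Pt : Matrix (Fin d) (Fin d) ℝ)
    (hPv : Pv = 1 - lam • (Uk * Ukᵀ))
    (hPt : Pt = 1 - lam • (Wk * Wkᵀ)) :
    ∑ i : Fin d, ∑ j : Fin d, ((Pvᵀ * C * Pt) i j) ^ 2 =
      (1 - lam) ^ 4 * (∑ i ∈ Finset.univ.filter (fun i : Fin d => (i : ℕ) < k), σ i ^ 2) +
      ∑ i ∈ Finset.univ.filter (fun i : Fin d => ¬ (i : ℕ) < k), σ i ^ 2 := by
  set c : Fin d → ℝ := fun i => if (i : ℕ) < k then 1 - lam else 1 with hc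
  have svd : Pvᵀ * C * Pt = U * diagonal (fun i => c i * σ i * c i) * Wᵀ := by
    rw [hPv, hPt, hUk, hWk, one_sub_smul_submatrix_castLE_mul_transpose hk lam hU,
      one_sub_smul_submatrix_castLE_mul_transpose hk lam hW, hC, ← hc]
    calc (U * diagonal c * Uᵀ)ᵀ * (U * diagonal σ * Wᵀ) * (W * diagonal c * Wᵀ)
        = U * (diagonal c * (Uᵀ * U) * diagonal σ * (Wᵀ * W) * diagonal c) * Wᵀ := by
          simp only [transpose_mul, transpose_transpose, diagonal_transpose, Matrix.mul_assoc]
      _ = _ := by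
          rw [hU, hW, Matrix.mul_one, Matrix.mul_one, diagonal_mul_diagonal,
            diagonal_mul_diagonal]
  rw [svd, sum_sq_mul_diagonal_mul_transpose hU hW,
    ← Finset.sum_filter_add_sum_filter_not univ (fun i : Fin d => (i : ℕ) < k), Finset.mul_sum]
  congr 1 <;> refine Finset.sum_congr rfl fun i hi => ?_
  · simp only [hc, if_pos (mem_filter.mp hi).2]
    ring
  · simp only [hc, if_neg (mem_filter.mp hi).2]
    ring
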